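/- arXiv:1706.06201 — 2 statements merged into one kernel-verified Lean document; each statement's English description precedes it below -/
import Mathlib

section
/- Let x : ℕ → ℝ be a real sequence, σ > 0 and ρ ∈ ℝ. Suppose the sample second moments converge: (1/n) ∑_{i=0}^{n−1} x_i² → σ² as n → ∞, and the sample lag-1 moments converge: (1/(n−1)) ∑_{i=1}^{n−1} x_i x_{i−1} → ρσ² as n → ∞. Then the squared ratio of deviations converges: RoD²(n) = ν²(n)/s²(n) → 2(1 − ρ) as n → ∞. -/
open Filter Finset

/-- The sum of squared successive differences, expanded into sums of squares and lag-1 products. -/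
lemma sum_Ico_sub_pred_sq (x : ℕ → ℝ) (m : ℕ) :
    ∑ i ∈ Ico 1 (m + 1), (x i - x (i - 1)) ^ 2 =
      ∑ i ∈ range (m + 1), x i ^ 2 - x 0 ^ 2 + ∑ i ∈ range m, x i ^ 2
        - 2 * ∑ i ∈ Ico 1 (m + 1), x i * x (i - 1) := by
  induction m with
  | zero => simp
  | succ k ih =>
    rw [sum_Ico_succ_top (by omega), sum_Ico_succ_top (by omega : 1 ≤ k + 1), ih,
      sum_range_succ _ (k + 1), sum_range_succ _ k, Nat.add_sub_cancel]
    ring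

/-- Zero-mean form of Proposition 1: if the sample second moments converge to `σ²` and the
sample lag-1 moments converge to `ρσ²`, then the squared ratio of deviations
`RoD²(n) = ν²(n)/s²(n)` converges to `2(1 − ρ)`. -/
theorem rod_sq_tendsto (x : ℕ → ℝ) (σ ρ : ℝ) (hσ : 0 < σ)
    (h1 : Tendsto (fun n : ℕ => (1 / (n : ℝ)) * ∑ i ∈ range n, (x i) ^ 2)
      atTop (nhds (σ ^ 2)))
    (h2 : Tendsto (fun n : ℕ => (1 / ((n : ℝ) - 1)) * ∑ i ∈ Ico 1 n, x i * x (i - 1))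
      atTop (nhds (ρ * σ ^ 2))) :
    Tendsto (fun n : ℕ =>
      ((1 / ((n : ℝ) - 1)) * ∑ i ∈ Ico 1 n, (x i - x (i - 1)) ^ 2) /
        ((1 / (n : ℝ)) * ∑ i ∈ range n, (x i) ^ 2))
      atTop (nhds (2 * (1 - ρ))) := by
  have hν : Tendsto (fun n : ℕ => (1 / ((n : ℝ) - 1)) * ∑ i ∈ Ico 1 n, (x i - x (i - 1)) ^ 2)
      atTop (nhds (2 * (1 - ρ) * σ ^ 2)) := by
    rw [← tendsto_add_atTop_iff_nat 1] at h2 ⊢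
    have hs := (tendsto_add_atTop_iff_nat 1).2 h1
    have hinv : Tendsto (fun m : ℕ => 1 / (m : ℝ)) atTop (nhds 0) :=
      tendsto_one_div_atTop_nhds_zero_nat
    have hlim := (((hs.mul (hinv.const_add 1)).sub (hinv.mul_const (x 0 ^ 2))).add h1).sub
      (h2.const_mul 2)
    rw [show σ ^ 2 * (1 + 0) - 0 * x 0 ^ 2 + σ ^ 2 - 2 * (ρ * σ ^ 2) =
      2 * (1 - ρ) * σ ^ 2 by ring] at hlim
    refine hlim.congr' ?_
    filter_upwards [eventually_gt_atTop 0] with m hm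
    have hm' : (m : ℝ) ≠ 0 := by positivity
    have hm1 : (m : ℝ) + 1 ≠ 0 := by positivity
    rw [sum_Ico_sub_pred_sq]
    push_cast
    rw [add_sub_cancel_right]
    field_simp
  have hσ2 : σ ^ 2 ≠ 0 := by positivity
  rw [← mul_div_cancel_right₀ (2 * (1 - ρ)) hσ2]
  exact hν.div h1 hσ2
end

section
/- Let x : ℕ → ℝ be a real sequence, μ ∈ ℝ, σ > 0 and ρ ∈ ℝ. Suppose (1/n) ∑_{i=0}^{n−1} x_i → μ, (1/n) ∑_{i=0}^{n−1} (x_i − μ)² → σ², and (1/(n−1)) ∑_{i=1}^{n−1} (x_i − μ)(x_{i−1} − μ) → ρσ² as n → ∞. Then ν²(n)/σ̂²(n) → 2(1 − ρ) as n → ∞, where ν²(n) = (1/(n−1)) ∑_{i=1}^{n−1} (x_i − x_{i−1})² and σ̂²(n) = (1/n) ∑_{i=0}^{n−1} (x_i − x̄_n)² is the sample variance computed about the sample mean x̄_n = (1/n) ∑_{i=0}^{n−1} x_i. -/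
open Filter Finset

/-- The sample variance about the sample mean is the second moment about `c` minus the squared
distance from the sample mean to `c`. -/
lemma sample_variance_eq (x : ℕ → ℝ) (c : ℝ) {n : ℕ} (hn : n ≠ 0) :
    (1 / (n : ℝ)) * ∑ i ∈ range n, (x i - (1 / (n : ℝ)) * ∑ j ∈ range n, x j) ^ 2 =
      (1 / (n : ℝ)) * ∑ i ∈ range n, (x i - c) ^ 2 -
        ((1 / (n : ℝ)) * ∑ i ∈ range n, x i - c) ^ 2 := by
  have hn' : (n : ℝ) ≠ 0 := Nat.cast_ne_zero.mpr hn
  simp only [sub_sq, sum_add_distrib, sum_sub_distrib, ← sum_mul, ← mul_sum, sum_const,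
    card_range, nsmul_eq_mul]
  field_simp
  ring

/-- Expansion of the sum of squared successive differences in terms of moments about `c`. -/
lemma sum_sq_succ_sub (x : ℕ → ℝ) (c : ℝ) (n : ℕ) :
    ∑ i ∈ Ico 1 (n + 1), (x i - x (i - 1)) ^ 2 =
      ∑ i ∈ range (n + 1), (x i - c) ^ 2 - (x 0 - c) ^ 2 + ∑ i ∈ range n, (x i - c) ^ 2 -
        2 * ∑ i ∈ Ico 1 (n + 1), (x i - c) * (x (i - 1) - c) := by
  induction n with
  | zero => simp
  | succ n ih =>
    rw [sum_Ico_succ_top (Nat.le_add_left 1 n), sum_Ico_succ_top (Nat.le_add_left 1 n), ih,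
      sum_range_succ _ (n + 1), sum_range_succ _ n]
    simp only [Nat.add_sub_cancel]
    ring

/-- If the averages `S n / n` converge, then `S (n + 1) / n` has the same limit. -/
lemma tendsto_one_div_mul_succ {S : ℕ → ℝ} {a : ℝ}
    (h : Tendsto (fun n : ℕ => (1 / (n : ℝ)) * S n) atTop (nhds a)) :
    Tendsto (fun n : ℕ => (1 / (n : ℝ)) * S (n + 1)) atTop (nhds a) := by
  have hq : Tendsto (fun n : ℕ => 1 + 1 / (n : ℝ)) atTop (nhds 1) := by
    simpa using (tendsto_one_div_atTop_nhds_zero_nat (𝕜 := ℝ)).const_add 1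
  have h' := hq.mul ((tendsto_add_atTop_iff_nat 1).mpr h)
  rw [one_mul] at h'
  refine h'.congr' ?_
  filter_upwards [eventually_ne_atTop 0] with n hn
  have hn' : (n : ℝ) ≠ 0 := Nat.cast_ne_zero.mpr hn
  push_cast
  field_simp

/-- Proposition 1 with nonzero limiting mean `μ`: if the sample means converge to `μ`, the
sample second moments about `μ` converge to `σ²`, and the sample lag-1 moments about `μ`
converge to `ρσ²`, then `ν²(n)/σ̂²(n)` converges to `2(1 − ρ)`, where `σ̂²(n)` is the sample
variance computed about the sample mean. -/
theorem rod_sq_tendsto_of_mean (x : ℕ → ℝ) (μ σ ρ : ℝ) (hσ : 0 < σ)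
    (h0 : Tendsto (fun n : ℕ => (1 / (n : ℝ)) * ∑ i ∈ range n, x i) atTop (nhds μ))
    (h1 : Tendsto (fun n : ℕ => (1 / (n : ℝ)) * ∑ i ∈ range n, (x i - μ) ^ 2)
      atTop (nhds (σ ^ 2)))
    (h2 : Tendsto (fun n : ℕ =>
        (1 / ((n : ℝ) - 1)) * ∑ i ∈ Ico 1 n, (x i - μ) * (x (i - 1) - μ))
      atTop (nhds (ρ * σ ^ 2))) :
    Tendsto (fun n : ℕ =>
      ((1 / ((n : ℝ) - 1)) * ∑ i ∈ Ico 1 n, (x i - x (i - 1)) ^ 2) /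
        ((1 / (n : ℝ)) * ∑ i ∈ range n, (x i - (1 / (n : ℝ)) * ∑ j ∈ range n, x j) ^ 2))
      atTop (nhds (2 * (1 - ρ))) := by
  have hden : Tendsto (fun n : ℕ =>
      (1 / (n : ℝ)) * ∑ i ∈ range n, (x i - (1 / (n : ℝ)) * ∑ j ∈ range n, x j) ^ 2)
      atTop (nhds (σ ^ 2)) := by
    have h := h1.sub ((h0.sub_const μ).pow 2)
    rw [sub_self, zero_pow two_ne_zero, sub_zero] at h
    refine h.congr' ?_
    filter_upwards [eventually_ne_atTop 0] with n hn
    exact (sample_variance_eq x μ hn).symm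
  have hnum : Tendsto (fun n : ℕ =>
      (1 / ((n : ℝ) - 1)) * ∑ i ∈ Ico 1 n, (x i - x (i - 1)) ^ 2)
      atTop (nhds (2 * (1 - ρ) * σ ^ 2)) := by
    rw [← tendsto_add_atTop_iff_nat 1] at h2 ⊢
    have hfirst : Tendsto (fun n : ℕ => (1 / (n : ℝ)) * (x 0 - μ) ^ 2) atTop (nhds 0) := by
      simpa using (tendsto_one_div_atTop_nhds_zero_nat (𝕜 := ℝ)).mul_const ((x 0 - μ) ^ 2)
    convert (((tendsto_one_div_mul_succ h1).sub hfirst).add h1).sub (h2.const_mul 2) using 2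
    · rw [sum_sq_succ_sub x μ]
      push_cast
      ring
    · ring
  have hσ2 : σ ^ 2 ≠ 0 := pow_ne_zero 2 hσ.ne'
  have h := hnum.div hden hσ2
  rwa [mul_div_cancel_right₀ _ hσ2] at h
end
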